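/- Every finite simple graph G with at least one vertex that contains no cycle of length 4 as a subgraph and is not isomorphic to the complete graph K₃ satisfies φ(G) ≥ χ(G) − 2. -/

import Mathlib

open SimpleGraph

/-- `σ` is a proper colouring of `G` with colours in `ℕ`. -/
def IsProperColoring {V : Type*} (G : SimpleGraph V) (σ : V → ℕ) : Prop :=
  ∀ ⦃u v : V⦄, G.Adj u v → σ u ≠ σ v

/-- The chromatic number of `G`, as a natural number. -/
noncomputable def chromNum {V : Type*} (G : SimpleGraph V) : ℕ :=
  sInf {n : ℕ | G.Colorable n}

/-- The discrepancy `φ_σ(G)` of a proper colouring `σ` of `G`: the maximum, over all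
induced subgraphs `G[S]` of `G`, of `|σ(S)| - χ(G[S])`. -/
noncomputable def colDisc {V : Type*} (G : SimpleGraph V) (σ : V → ℕ) : ℤ :=
  sSup {z : ℤ | ∃ S : Set V, z = ((σ '' S).ncard : ℤ) - (chromNum (G.induce S) : ℤ)}

/-- The chromatic discrepancy `φ(G)`: the minimum of `φ_σ(G)` over all proper
colourings `σ` of `G`. -/
noncomputable def chromDisc {V : Type*} (G : SimpleGraph V) : ℤ :=
  sInf {z : ℤ | ∃ σ : V → ℕ, IsProperColoring G σ ∧ z = colDisc G σ}

/-- `G` is locally `s`-colourable: the closed neighbourhood of every vertex induces an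
`s`-colourable subgraph. -/
def LocallyColorable {V : Type*} (G : SimpleGraph V) (s : ℕ) : Prop :=
  ∀ v : V, chromNum (G.induce (insert v (G.neighborSet v))) ≤ s

/-- The set of vertices at distance at most `r` from `v` in `G`. -/
def ballSet {V : Type*} (G : SimpleGraph V) (v : V) (r : ℕ) : Set V :=
  {u : V | ∃ w : G.Walk v u, w.length ≤ r}

/-- `G` is `r`-locally `s`-colourable: every ball of radius `r` induces an
`s`-colourable subgraph. -/
def RLocallyColorable {V : Type*} (G : SimpleGraph V) (r s : ℕ) : Prop :=
  ∀ v : V, chromNum (G.induce (ballSet G v r)) ≤ s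

/-- `G` contains no cycle of length exactly `n` as a (not necessarily induced) subgraph. -/
def CycleLenFree {V : Type*} (G : SimpleGraph V) (n : ℕ) : Prop :=
  ∀ (v : V) (w : G.Walk v v), w.IsCycle → w.length ≠ n

/-- `H` is `k`-degenerate: every non-empty (induced) subgraph contains a vertex of
degree at most `k` in it. -/
def Degenerate {α : Type*} (H : SimpleGraph α) (k : ℕ) : Prop :=
  ∀ S : Set α, S.Nonempty → ∃ a ∈ S, {b | b ∈ S ∧ H.Adj a b}.ncard ≤ k

/-- `G` is co-locally `s`-colourable: for all vertices `u ≠ v`,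
`χ(G[{u} ∪ N(v)]) ≤ s`. -/
def CoLocallyColorable {V : Type*} (G : SimpleGraph V) (s : ℕ) : Prop :=
  ∀ v u : V, u ≠ v → chromNum (G.induce (insert u (G.neighborSet v))) ≤ s

/-- The minimum of `χ(G[X])` over all subsets `X ⊆ V(G)` spanning exactly `p` colours
of `σ` (a rainbow cover of `σ` when `σ` uses exactly `p` colours). -/
noncomputable def minRainbowChrom {V : Type*} (G : SimpleGraph V) (σ : V → ℕ) (p : ℕ) : ℕ :=
  sInf {c : ℕ | ∃ X : Set V, (σ '' X).ncard = p ∧ c = chromNum (G.induce X)}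

/-- `f_G(p)`: the maximum, over all proper colourings `σ` of `G` using exactly `p`
colours, of the minimum chromatic number of a rainbow cover of `σ`. -/
noncomputable def fG {V : Type*} (G : SimpleGraph V) (p : ℕ) : ℕ :=
  sSup {m : ℕ | ∃ σ : V → ℕ, IsProperColoring G σ ∧ (σ '' Set.univ).ncard = p ∧
    m = minRainbowChrom G σ p}

/-- The closed neighbourhood `N[X]` of a set `X` of vertices. -/
def closedNbhd {V : Type*} (G : SimpleGraph V) (X : Set V) : Set V :=
  X ∪ {u : V | ∃ x ∈ X, G.Adj x u}

/-- `X` can be properly coloured with `n` colours. -/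
def ColOn {V : Type*} (G : SimpleGraph V) (X : Set V) (n : ℕ) : Prop :=
  ∃ c : V → ℕ, (∀ x ∈ X, c x < n) ∧ ∀ x ∈ X, ∀ y ∈ X, G.Adj x y → c x ≠ c y

/-- Usable form of `C₄`-freeness. -/
def NoC4 {V : Type*} (G : SimpleGraph V) : Prop :=
  ∀ a b c d : V, a ≠ c → b ≠ d → G.Adj a b → G.Adj b c → G.Adj c d → G.Adj d a → False

lemma noC4_of_cycleLenFree {V : Type*} (G : SimpleGraph V) (h4 : CycleLenFree G 4) :
    NoC4 G := by
  intro a b c d hac hbd hab hbc hcd hda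
  refine h4 a (Walk.cons hab (Walk.cons hbc (Walk.cons hcd (Walk.cons hda Walk.nil)))) ?_ rfl
  rw [Walk.cons_isCycle_iff]
  have h1 := hab.ne
  have h2 := hbc.ne
  have h3 := hcd.ne
  have h5 := hda.ne
  constructor
  · simp only [Walk.cons_isPath_iff, Walk.support_cons, Walk.support_nil]
    simp
    grind
  · simp
    grind

lemma ColOn.chromNum_le {V : Type*} {G : SimpleGraph V} {X : Set V} {n : ℕ}
    (h : ColOn G X n) : chromNum (G.induce X) ≤ n := by
  obtain ⟨c, hc, hp⟩ := h
  refine Nat.sInf_le ?_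
  refine ⟨SimpleGraph.Coloring.mk (fun x : X => (⟨c x.1, hc x.1 x.2⟩ : Fin n)) ?_⟩
  intro x y hxy h
  exact hp x.1 x.2 y.1 y.2 hxy (by simpa using h)

lemma chromNum_le_card {V : Type*} [Fintype V] {G : SimpleGraph V} {σ : V → ℕ}
    (h : IsProperColoring G σ) : chromNum G ≤ (Finset.univ.image σ).card := by
  classical
  refine Nat.sInf_le ?_
  have : G.Colorable (Fintype.card (Finset.univ.image σ)) := by
    refine SimpleGraph.Coloring.colorable
      (SimpleGraph.Coloring.mk (fun x : V => (⟨σ x, by simp⟩ : Finset.univ.image σ)) ?_)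
    intro x y hxy he
    exact h hxy (by simpa using he)
  simpa using this

/-- Choosing between two matchings, avoiding a prescribed choice. -/
lemma choose_two (N M : ℕ → ℕ → Prop) (hN : ∀ i j, N i j → N j i) (hM : ∀ i j, M i j → M j i)
    (hN1 : ∀ i j k, N i j → N i k → j = k) (hM1 : ∀ i j k, M i j → M i k → j = k) :
    ∀ (n : ℕ) (A : Finset ℕ), A.card = n → ∀ i0, ∃ P : ℕ → Prop, ¬ P i0 ∧
      (∀ i ∈ A, ∀ j ∈ A, i ≠ j → P i → P j → ¬ N i j) ∧
      (∀ i ∈ A, ∀ j ∈ A, i ≠ j → ¬ P i → ¬ P j → ¬ M i j) := by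
  intro n
  induction n using Nat.strong_induction_on with
  | _ n ih =>
  intro A hA
  -- it suffices to treat `i0 ∈ A`
  have main : ∀ i0 ∈ A, ∃ P : ℕ → Prop, ¬ P i0 ∧
      (∀ i ∈ A, ∀ j ∈ A, i ≠ j → P i → P j → ¬ N i j) ∧
      (∀ i ∈ A, ∀ j ∈ A, i ≠ j → ¬ P i → ¬ P j → ¬ M i j) := by
    intro i0 hi0
    by_cases hj : ∃ j ∈ A, j ≠ i0 ∧ M i0 j
    · obtain ⟨j, hjA, hji, hij⟩ := hj
      have hk : ∃ k, ∀ k' ∈ A, k' ≠ i0 → k' ≠ j → N j k' → k' = k := by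
        by_cases h : ∃ k, N j k
        · obtain ⟨k, hk⟩ := h
          exact ⟨k, fun k' _ _ _ h' => hN1 _ _ _ h' hk⟩
        · exact ⟨0, fun k' _ _ _ h' => (h ⟨k', h'⟩).elim⟩
      obtain ⟨k, hk⟩ := hk
      have hlt : ((A.erase i0).erase j).card < n := by
        rw [← hA]
        exact lt_of_le_of_lt (Finset.card_le_card (Finset.erase_subset _ _))
          (Finset.card_erase_lt_of_mem hi0)
      obtain ⟨P, hP0, hP1, hP2⟩ := ih _ hlt _ rfl k
      refine ⟨fun i => i = j ∨ (i ≠ i0 ∧ P i), ?_, ?_, ?_⟩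
      · grind
      · intro a ha b hb hab h1 h2 h3
        have := hN _ _ h3
        grind
      · intro a ha b hb hab h1 h2 h3
        have := hM _ _ h3
        grind
    · have hlt : (A.erase i0).card < n := by
        rw [← hA]
        exact Finset.card_erase_lt_of_mem hi0
      obtain ⟨P, hP0, hP1, hP2⟩ := ih _ hlt _ rfl i0
      refine ⟨P, hP0, ?_, ?_⟩
      · intro a ha b hb hab h1 h2 h3
        grind
      · intro a ha b hb hab h1 h2 h3
        have := hM _ _ h3
        grind
  intro i0
  by_cases hi0 : i0 ∈ A
  · exact main i0 hi0
  · rcases A.eq_empty_or_nonempty with rfl | ⟨i, hi⟩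
    · exact ⟨fun _ => False, by simp⟩
    · obtain ⟨P, hP0, hP1, hP2⟩ := main i hi
      refine ⟨fun x => x ≠ i0 ∧ P x, by simp, ?_, ?_⟩ <;> grind

/-- `A` has an independent transversal `r`. -/
def IndT {V : Type*} (G : SimpleGraph V) (σ : V → ℕ) (A : Finset ℕ) : Prop :=
  ∃ r : ℕ → V, (∀ i ∈ A, σ (r i) = i) ∧ ∀ i ∈ A, ∀ j ∈ A, ¬ G.Adj (r i) (r j)

/-- Three hubs in a path yield a larger independent rainbow set. -/
lemma three_hubs {V : Type*} (G : SimpleGraph V) (hC : NoC4 G) (σ : V → ℕ)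
    (A : Finset ℕ)
    (w1 w2 w3 : V) (h1 : σ w1 ∉ A) (h2 : σ w2 ∉ A) (h3 : σ w3 ∉ A)
    (h13 : w1 ≠ w3) (h12 : G.Adj w1 w2) (h23 : G.Adj w2 w3)
    (s2 : ∀ i ∈ A, ∃ x, σ x = i ∧ G.Adj w2 x) (s3 : ∀ i ∈ A, ∃ x, σ x = i ∧ G.Adj w3 x) :
    IndT G σ (insert (σ w1) A) := by
  classical
  have e2 : ∃ n : ℕ → V, ∀ i ∈ A, σ (n i) = i ∧ G.Adj w2 (n i) := by
    refine ⟨fun i => if h : i ∈ A then (s2 i h).choose else w1, fun i hi => ?_⟩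
    simp only [hi, dif_pos]
    exact (s2 i hi).choose_spec
  have e3 : ∃ n : ℕ → V, ∀ i ∈ A, σ (n i) = i ∧ G.Adj w3 (n i) := by
    refine ⟨fun i => if h : i ∈ A then (s3 i h).choose else w1, fun i hi => ?_⟩
    simp only [hi, dif_pos]
    exact (s3 i hi).choose_spec
  obtain ⟨n, hn⟩ := e2
  obtain ⟨m, hm⟩ := e3
  have hninj : ∀ i ∈ A, ∀ j ∈ A, n i = n j → i = j := fun i hi j hj h => by
    rw [← (hn i hi).1, ← (hn j hj).1, h]
  have hminj : ∀ i ∈ A, ∀ j ∈ A, m i = m j → i = j := fun i hi j hj h => by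
    rw [← (hm i hi).1, ← (hm j hj).1, h]
  have hi0 : ∃ i0, ∀ i ∈ A, G.Adj w1 (n i) → i = i0 := by
    by_cases h : ∃ i ∈ A, G.Adj w1 (n i)
    · obtain ⟨i0, hi0, h0⟩ := h
      refine ⟨i0, fun i hi h => ?_⟩
      by_contra hne
      exact hC w1 (n i) w2 (n i0) h12.ne (fun h => hne (hninj _ hi _ hi0 h)) h
        (hn i hi).2.symm (hn i0 hi0).2 h0.symm
    · exact ⟨0, fun i hi h' => (h ⟨i, hi, h'⟩).elim⟩
  obtain ⟨i0, hi0⟩ := hi0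
  obtain ⟨P, hP0, hP1, hP2⟩ := choose_two
    (fun i j => i ∈ A ∧ j ∈ A ∧ G.Adj (n i) (n j))
    (fun i j => i ∈ A ∧ j ∈ A ∧ G.Adj (m i) (m j))
    (fun i j h => ⟨h.2.1, h.1, h.2.2.symm⟩) (fun i j h => ⟨h.2.1, h.1, h.2.2.symm⟩)
    (by
      rintro i j k ⟨hi, hj, hij⟩ ⟨-, hk, hik⟩
      by_contra hne
      refine hC w2 (n j) (n i) (n k) ?_ (fun h => hne (hninj _ hj _ hk h)) (hn j hj).2 hij.symm hik
        (hn k hk).2.symm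
      exact (hn i hi).2.ne)
    (by
      rintro i j k ⟨hi, hj, hij⟩ ⟨-, hk, hik⟩
      by_contra hne
      refine hC w3 (m j) (m i) (m k) ?_ (fun h => hne (hminj _ hj _ hk h)) (hm j hj).2 hij.symm hik
        (hm k hk).2.symm
      exact (hm i hi).2.ne) _ A rfl i0
  have hnm : ∀ i ∈ A, ∀ j ∈ A, i ≠ j → ¬ G.Adj (n i) (m j) := by
    intro i hi j hj hij h
    refine hC w2 (n i) (m j) w3 ?_ ?_ (hn i hi).2 h (hm j hj).2.symm h23.symm
    · intro h; apply h2; rw [h, (hm j hj).1]; exact hj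
    · intro h; apply h3; rw [← h, (hn i hi).1]; exact hi
  have hw1m : ∀ i ∈ A, ¬ G.Adj w1 (m i) := by
    intro i hi h
    refine hC w1 w2 w3 (m i) h13 ?_ h12 h23 (hm i hi).2 h.symm
    intro h; apply h2; rw [h, (hm i hi).1]; exact hi
  have hw1n : ∀ i ∈ A, P i → ¬ G.Adj w1 (n i) := by
    intro i hi hPi h
    exact hP0 (hi0 i hi h ▸ hPi)
  let q : ℕ → V := fun i => if P i then n i else m i
  have hq : ∀ i ∈ A, σ (q i) = i := by
    intro i hi
    by_cases h : P i
    · simp [q, h, (hn i hi).1]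
    · simp [q, h, (hm i hi).1]
  have hqw : ∀ i ∈ A, ¬ G.Adj w1 (q i) := by
    intro i hi
    by_cases h : P i
    · simp only [q, h, if_true]; exact hw1n i hi h
    · simp only [q, h, if_false]; exact hw1m i hi
  have hqq : ∀ i ∈ A, ∀ j ∈ A, ¬ G.Adj (q i) (q j) := by
    intro i hi j hj hadj
    by_cases hij : i = j
    · subst hij; exact G.loopless.irrefl _ hadj
    by_cases hi' : P i <;> by_cases hj' : P j <;> simp only [q, hi', hj', if_true, if_false] at hadj
    · exact hP1 i hi j hj hij hi' hj' ⟨hi, hj, hadj⟩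
    · exact hnm i hi j hj hij hadj
    · exact hnm j hj i hi (Ne.symm hij) hadj.symm
    · exact hP2 i hi j hj hij hi' hj' ⟨hi, hj, hadj⟩
  refine ⟨fun i => if i = σ w1 then w1 else q i, ?_, ?_⟩
  · intro i hi
    by_cases h : i = σ w1
    · simp [h]
    · simp only [h, if_false]
      exact hq i (by simpa [h] using hi)
  · intro i hi j hj
    by_cases h : i = σ w1 <;> by_cases h' : j = σ w1 <;> simp only [h, h', if_true, if_false]
    · exact G.loopless.irrefl _
    · exact hqw j (by simpa [h'] using hj)
    · exact fun hh => hqw i (by simpa [h] using hi) hh.symm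
    · exact hqq i (by simpa [h] using hi) j (by simpa [h'] using hj)

/-- A rainbow set with maximum degree at most one is properly 2-coloured as follows. -/
lemma two_col {V : Type*} (G : SimpleGraph V) (σ : V → ℕ) (hσ : IsProperColoring G σ) (Y : Set V)
    (h : ∀ x ∈ Y, ∀ y ∈ Y, ∀ z ∈ Y, G.Adj x y → G.Adj x z → y = z) : ColOn G Y 2 := by
  classical
  refine ⟨fun x => if ∃ y ∈ Y, G.Adj x y ∧ σ y < σ x then 1 else 0, ?_, ?_⟩
  · intro x _; dsimp only; split_ifs <;> omega
  · intro x hx y hy hxy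
    have := hσ hxy
    rcases lt_or_gt_of_ne this with hlt | hlt
    · have h1 : ∃ z ∈ Y, G.Adj y z ∧ σ z < σ y := ⟨x, hx, hxy.symm, hlt⟩
      have h2 : ¬ ∃ z ∈ Y, G.Adj x z ∧ σ z < σ x := by
        rintro ⟨z, hz, hxz, hl⟩
        have := h x hx y hy z hz hxy hxz
        subst this; omega
      simp only [h1, h2, if_true, if_false]; omega
    · have h1 : ∃ z ∈ Y, G.Adj x z ∧ σ z < σ x := ⟨y, hy, hxy, hlt⟩
      have h2 : ¬ ∃ z ∈ Y, G.Adj y z ∧ σ z < σ y := by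
        rintro ⟨z, hz, hxz, hl⟩
        have := h y hy x hx z hz hxy.symm hxz
        subst this; omega
      simp only [h1, h2, if_true, if_false]; omega

/-- Adding an independent set costs one colour. -/
lemma ColOn.add_indep {V : Type*} {G : SimpleGraph V} {X J : Set V} {n : ℕ}
    (h : ColOn G X n) (hJ : ∀ x ∈ J, ∀ y ∈ J, ¬ G.Adj x y) : ColOn G (X ∪ J) (n + 1) := by
  classical
  obtain ⟨c, hc, hp⟩ := h
  refine ⟨fun x => if x ∈ J then n else c x, ?_, ?_⟩
  · intro x hx
    by_cases hxJ : x ∈ J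
    · simp [hxJ]
    · have := hc x (by simpa [hxJ] using hx)
      simp only [hxJ, if_false]; omega
  · intro x hx y hy hxy
    by_cases hxJ : x ∈ J <;> by_cases hyJ : y ∈ J <;> simp only [hxJ, hyJ, if_true, if_false]
    · exact (hJ x hxJ y hyJ hxy).elim
    · have := hc y (by simpa [hyJ] using hy); omega
    · have := hc x (by simpa [hxJ] using hx); omega
    · exact hp x (by simpa [hxJ] using hx) y (by simpa [hyJ] using hy) hxy

/-- Adding a vertex with at most one neighbour to a 2-colourable set. -/
lemma ColOn.add_pendant {V : Type*} {G : SimpleGraph V} {X : Set V} (u : V)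
    (h : ColOn G X 2) (hu : u ∉ X)
    (h1 : ∀ x ∈ X, ∀ y ∈ X, G.Adj u x → G.Adj u y → x = y) : ColOn G (insert u X) 2 := by
  classical
  obtain ⟨c, hc, hp⟩ := h
  have : ∃ k < 2, ∀ x ∈ X, G.Adj u x → c x ≠ k := by
    by_cases h : ∃ x ∈ X, G.Adj u x
    · obtain ⟨x, hx, hux⟩ := h
      have := hc x hx
      refine ⟨1 - c x, by omega, fun y hy huy => ?_⟩
      rw [h1 y hy x hx huy hux]; omega
    · exact ⟨0, by omega, fun x hx hux => (h ⟨x, hx, hux⟩).elim⟩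
  obtain ⟨k, hk, hk'⟩ := this
  refine ⟨fun x => if x = u then k else c x, ?_, ?_⟩
  · intro x hx
    by_cases hxu : x = u
    · simp [hxu, hk]
    · simp only [hxu, if_false]; exact hc x (by simpa [hxu] using hx)
  · intro x hx y hy hxy
    by_cases hxu : x = u <;> by_cases hyu : y = u <;> simp only [hxu, hyu, if_true, if_false]
    · subst hxu; subst hyu; exact (G.loopless.irrefl _ hxy).elim
    · subst hxu; exact (hk' y (by simpa [hyu] using hy) hxy).symm
    · subst hyu; exact hk' x (by simpa [hxu] using hx) hxy.symm
    · exact hp x (by simpa [hxu] using hx) y (by simpa [hyu] using hy) hxy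

/-- Recolouring a colour class `e` into the colours `A`. -/
lemma recolor {V : Type*} [Fintype V] (G : SimpleGraph V) (σ : V → ℕ)
    (hσ : IsProperColoring G σ) (A : Finset ℕ) (hA : A ⊆ Finset.univ.image σ) (e : ℕ)
    (heA : e ∉ A) (he : e ∈ Finset.univ.image σ)
    (hmiss : ∀ v, σ v = e → ∃ i ∈ A, ∀ x, G.Adj v x → σ x ≠ i) :
    ∃ σ' : V → ℕ, IsProperColoring G σ' ∧ (∀ v, σ v ≠ e → σ' v = σ v) ∧
      (∀ v, σ v = e → σ' v ∈ A) ∧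
      Finset.univ.image σ' = (Finset.univ.image σ).erase e := by
  classical
  choose! g hgA hg using hmiss
  refine ⟨fun v => if σ v = e then g v else σ v, ?_, ?_, ?_, ?_⟩
  · intro x y hxy
    have := hσ hxy
    by_cases hx : σ x = e <;> by_cases hy : σ y = e <;> simp only [hx, hy, if_true, if_false]
    · exact (this (hx.trans hy.symm)).elim
    · exact (hg x hx y hxy).symm
    · exact hg y hy x hxy.symm
    · exact this
  · intro v hv; simp [hv]
  · intro v hv; simp only [hv, if_true]; exact hgA v hv
  · ext i
    simp only [Finset.mem_image, Finset.mem_univ, true_and, Finset.mem_erase]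
    constructor
    · rintro ⟨v, rfl⟩
      by_cases hv : σ v = e
      · simp only [hv, if_true]
        refine ⟨fun h => heA (h ▸ hgA v hv), ?_⟩
        simpa using hA (hgA v hv)
      · simp only [hv, if_false]
        exact ⟨hv, v, rfl⟩
    · rintro ⟨hne, v, rfl⟩
      exact ⟨v, by simp [hne]⟩

/-- The case where the number of colours equals the chromatic number. -/
lemma base_case {V : Type*} [Fintype V] (G : SimpleGraph V) (hC : NoC4 G)
    (hK : ¬ Nonempty (G ≃g (⊤ : SimpleGraph (Fin 3)))) (σ : V → ℕ)
    (hσ : IsProperColoring G σ) (hp : (Finset.univ.image σ).card ≤ chromNum G) :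
    ∃ X : Set V, (∀ v, ∃ x ∈ X, σ x = σ v) ∧ ColOn G X 2 := by
  classical
  have hb : ∀ v0 : V, ∃ v, σ v = σ v0 ∧ ∀ w, σ w ≠ σ v0 → ∃ x, G.Adj v x ∧ σ x = σ w := by
    intro v0
    by_contra hcon
    push Not at hcon
    obtain ⟨σ', h1, -, -, h4⟩ := recolor G σ hσ ((Finset.univ.image σ).erase (σ v0))
      (Finset.erase_subset _ _) (σ v0) (by simp) (by simp) (by
        intro v hv
        obtain ⟨w, hw, hw'⟩ := hcon v hv
        exact ⟨σ w, by simp [hw], hw'⟩)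
    have := chromNum_le_card h1
    rw [h4, Finset.card_erase_of_mem (by simp)] at this
    have : 0 < (Finset.univ.image σ).card := Finset.card_pos.2 ⟨σ v0, by simp⟩
    omega
  by_cases hinj : Function.Injective σ
  · -- complete graph
    have hcomp : ∀ x y, x ≠ y → G.Adj x y := by
      intro x y hxy
      obtain ⟨v, hv, h⟩ := hb x
      obtain rfl := hinj hv
      obtain ⟨z, hz, hzy⟩ := h y (fun h => hxy (hinj h).symm)
      obtain rfl := hinj hzy
      exact hz
    have hcard : Fintype.card V ≤ 2 := by
      by_contra hgt
      by_cases h3 : Fintype.card V = 3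
      · apply hK
        have eq : V ≃ Fin 3 := Fintype.equivFinOfCardEq h3
        refine ⟨⟨eq, ?_⟩⟩
        intro a b
        simp only [top_adj, ne_eq, EmbeddingLike.apply_eq_iff_eq]
        exact ⟨hcomp a b, fun h => h.ne⟩
      · have h4 : 4 ≤ Fintype.card V := by omega
        obtain ⟨f⟩ : Nonempty (Fin 4 ↪ V) :=
          Function.Embedding.nonempty_of_card_le (by simpa using h4)
        have hf : ∀ i j, i ≠ j → G.Adj (f i) (f j) := fun i j h =>
          hcomp _ _ (fun h' => h (f.injective h'))
        exact hC (f 0) (f 1) (f 2) (f 3) (hf 0 2 (by decide)).ne (hf 1 3 (by decide)).ne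
          (hf _ _ (by decide)) (hf _ _ (by decide)) (hf _ _ (by decide)) (hf _ _ (by decide))
    refine ⟨Set.univ, fun v => ⟨v, trivial, rfl⟩, fun x => Fintype.equivFin V x, ?_, ?_⟩
    · intro x _
      exact lt_of_lt_of_le (Fintype.equivFin V x).2 hcard
    · intro x _ y _ hxy h
      exact hxy.ne ((Fintype.equivFin V).injective (Fin.ext h))
  · simp only [Function.Injective, not_forall] at hinj
    obtain ⟨u0, u1, hu, hne⟩ := hinj
    obtain ⟨v, hv, hsee⟩ := hb u0
    obtain ⟨u, huv, huc⟩ : ∃ u, u ≠ v ∧ σ u = σ v := by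
      by_cases h : u0 = v
      · exact ⟨u1, fun h' => hne (h.trans h'.symm), by rw [hv, hu]⟩
      · exact ⟨u0, h, hv.symm⟩
    have : ∃ n : ℕ → V, ∀ i, i ≠ σ v → (∃ w, σ w = i) → G.Adj v (n i) ∧ σ (n i) = i := by
      refine ⟨fun i => if h : ∃ x, G.Adj v x ∧ σ x = i then h.choose else v, ?_⟩
      rintro i hi ⟨w, rfl⟩
      have h := hsee w (by rwa [← hv])
      simp only [h, dif_pos]
      exact h.choose_spec
    obtain ⟨n, hn⟩ := this
    let Y : Set V := {x | ∃ i, i ≠ σ v ∧ (∃ w, σ w = i) ∧ x = n i}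
    have hYv : ∀ x ∈ Y, G.Adj v x := by
      rintro x ⟨i, hi, hw, rfl⟩; exact (hn i hi hw).1
    refine ⟨insert u Y, ?_, ?_⟩
    · intro w
      by_cases hw : σ w = σ v
      · exact ⟨u, Set.mem_insert _ _, by rw [huc, hw]⟩
      · exact ⟨n (σ w), Set.mem_insert_of_mem _ ⟨σ w, hw, ⟨w, rfl⟩, rfl⟩, (hn _ hw ⟨w, rfl⟩).2⟩
    · apply ColOn.add_pendant
      · apply two_col G σ hσ
        intro x hx y hy z hz hxy hxz
        by_contra hyz
        exact hC v y x z (hYv x hx).ne hyz (hYv y hy) hxy.symm hxz (hYv z hz).symm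
      · intro hu
        exact hσ (hYv u hu) huc.symm
      · intro x hx y hy hux huy
        by_contra hxy
        exact hC v x u y huv.symm hxy (hYv x hx) hux.symm huy (hYv y hy).symm

/-- Main induction on the number of colours. -/
lemma key {V : Type*} [Fintype V] (G : SimpleGraph V) (hC : NoC4 G)
    (hK : ¬ Nonempty (G ≃g (⊤ : SimpleGraph (Fin 3)))) :
    ∀ (p : ℕ) (σ : V → ℕ), IsProperColoring G σ → (Finset.univ.image σ).card = p →
      ∃ X : Set V, (∀ v, ∃ x ∈ X, σ x = σ v) ∧
        ∃ n, ColOn G X n ∧ n + chromNum G ≤ p + 2 := by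
  classical
  intro p
  induction p with
  | zero =>
    intro σ hσ hp
    obtain ⟨X, h1, h2⟩ := base_case G hC hK σ hσ (by omega)
    have := chromNum_le_card hσ
    exact ⟨X, h1, 2, h2, by omega⟩
  | succ p ih =>
    intro σ hσ hp
    have hle := chromNum_le_card hσ
    by_cases hpc : (Finset.univ.image σ).card ≤ chromNum G
    · obtain ⟨X, h1, h2⟩ := base_case G hC hK σ hσ hpc
      exact ⟨X, h1, 2, h2, by omega⟩
    -- a maximum colour set with an independent transversal
    have hV : Nonempty V := by
      have : (Finset.univ.image σ).Nonempty := Finset.card_pos.1 (by omega)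
      obtain ⟨i, hi⟩ := this
      obtain ⟨v, -, -⟩ := Finset.mem_image.1 hi
      exact ⟨v⟩
    obtain ⟨A, hAmem, hAmax⟩ := Finset.exists_max_image
      ((Finset.univ.image σ).powerset.filter (fun A => IndT G σ A)) Finset.card
      ⟨∅, by
        simp only [Finset.mem_filter, Finset.empty_mem_powerset, true_and]
        exact ⟨fun _ => hV.some, by simp, by simp⟩⟩
    simp only [Finset.mem_filter, Finset.mem_powerset] at hAmem hAmax
    obtain ⟨hAsub, r, hr, hrind⟩ := hAmem
    let J : Set V := {x | ∃ i ∈ A, x = r i}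
    have hJ : ∀ x ∈ J, ∀ y ∈ J, ¬ G.Adj x y := by
      rintro x ⟨i, hi, rfl⟩ y ⟨j, hj, rfl⟩
      exact hrind i hi j hj
    by_cases hred : ∃ e, e ∉ A ∧ e ∈ Finset.univ.image σ ∧
        ∀ v, σ v = e → ∃ i ∈ A, ∀ x, G.Adj v x → σ x ≠ i
    · obtain ⟨e, heA, he, hmiss⟩ := hred
      obtain ⟨σ', h1, h2, h3, h4⟩ := recolor G σ hσ A hAsub e heA he hmiss
      obtain ⟨X, hX, n, hXn, hn⟩ := ih σ' h1 (by
        rw [h4, Finset.card_erase_of_mem he]; omega)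
      by_cases hXe : ∃ x ∈ X, σ x = e
      · refine ⟨X ∪ J, ?_, n + 1, hXn.add_indep hJ, by omega⟩
        intro v
        by_cases hve : σ v = e
        · obtain ⟨x, hx, hxe⟩ := hXe
          exact ⟨x, Or.inl hx, by rw [hxe, hve]⟩
        by_cases hvA : σ v ∈ A
        · exact ⟨r (σ v), Or.inr ⟨_, hvA, rfl⟩, hr _ hvA⟩
        · obtain ⟨x, hx, hxv⟩ := hX v
          rw [h2 v hve] at hxv
          refine ⟨x, Or.inl hx, ?_⟩
          by_cases hxe : σ x = e
          · exact (hvA (hxv ▸ h3 x hxe)).elim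
          · rw [← hxv, h2 x hxe]
      · obtain ⟨y, -, hy⟩ := Finset.mem_image.1 he
        refine ⟨X ∪ {y}, ?_, n + 1, hXn.add_indep ?_, by omega⟩
        · intro v
          by_cases hve : σ v = e
          · exact ⟨y, Or.inr rfl, by rw [hy, hve]⟩
          · obtain ⟨x, hx, hxv⟩ := hX v
            refine ⟨x, Or.inl hx, ?_⟩
            rw [← h2 v hve, ← hxv, h2 x (fun h => hXe ⟨x, hx, h⟩)]
        · rintro a rfl b rfl
          exact G.loopless.irrefl _
    · push Not at hred
      choose! w hwσ hw using hred
      let Y : Set V := {x | ∃ e, e ∉ A ∧ e ∈ Finset.univ.image σ ∧ x = w e}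
      have hYA : ∀ x ∈ Y, σ x ∉ A := by
        rintro x ⟨e, h1, h2, rfl⟩
        rwa [hwσ e h1 h2]
      have hYs : ∀ x ∈ Y, ∀ i ∈ A, ∃ z, σ z = i ∧ G.Adj x z := by
        rintro x ⟨e, h1, h2, rfl⟩ i hi
        obtain ⟨z, hz, hz'⟩ := hw e h1 h2 i hi
        exact ⟨z, hz', hz⟩
      have hY2 : ColOn G Y 2 := by
        apply two_col G σ hσ
        intro x hx y hy z hz hxy hxz
        by_contra hyz
        have hT := three_hubs G hC σ A y x z (hYA y hy) (hYA x hx) (hYA z hz) hyz hxy.symm hxz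
          (hYs x hx) (hYs z hz)
        have := hAmax (insert (σ y) A)
          ⟨Finset.insert_subset (by simp) hAsub, hT⟩
        rw [Finset.card_insert_of_notMem (hYA y hy)] at this
        omega
      refine ⟨Y ∪ J, ?_, 3, hY2.add_indep hJ, by omega⟩
      intro v
      by_cases hvA : σ v ∈ A
      · exact ⟨r (σ v), Or.inr ⟨_, hvA, rfl⟩, hr _ hvA⟩
      · exact ⟨w (σ v), Or.inl ⟨_, hvA, by simp, rfl⟩, hwσ _ hvA (by simp)⟩

/-- Every finite `C₄`-free simple graph `G` with at least one vertex that
is not isomorphic to `K₃` satisfies `φ(G) ≥ χ(G) - 2`. -/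
theorem c4Free_chromDisc {V : Type*} [Fintype V] [Nonempty V] (G : SimpleGraph V)
    (h4 : CycleLenFree G 4) (hK : ¬ Nonempty (G ≃g (⊤ : SimpleGraph (Fin 3)))) :
    chromDisc G ≥ (chromNum G : ℤ) - 2 := by
  have hC := noC4_of_cycleLenFree G h4
  refine le_csInf ?_ ?_
  · refine ⟨_, fun v => (Fintype.equivFin V v : ℕ), ?_, rfl⟩
    intro x y hxy h
    exact hxy.ne ((Fintype.equivFin V).injective (Fin.ext h))
  · rintro z ⟨σ, hσ, rfl⟩
    classical
    obtain ⟨X, hX, n, hXn, hn⟩ := key G hC hK _ σ hσ rfl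
    have hle := hXn.chromNum_le
    have himg : σ '' X = ((Finset.univ.image σ : Finset ℕ) : Set ℕ) := by
      ext i
      simp only [Set.mem_image, Finset.coe_image, Finset.coe_univ, Set.image_univ, Set.mem_range]
      constructor
      · rintro ⟨x, -, rfl⟩; exact ⟨x, rfl⟩
      · rintro ⟨v, rfl⟩; exact hX v
    have hcard : (σ '' X).ncard = (Finset.univ.image σ).card := by
      rw [himg, Set.ncard_coe_finset]
    refine le_trans ?_ (le_csSup ?_ ⟨X, rfl⟩)
    · omega
    · refine ⟨(Fintype.card V : ℤ), ?_⟩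
      rintro z ⟨S, rfl⟩
      have h1 : (σ '' S).ncard ≤ S.ncard := Set.ncard_image_le (Set.toFinite S)
      have h2 : S.ncard ≤ Fintype.card V := by
        rw [← Nat.card_eq_fintype_card]; exact Set.ncard_le_card S
      omega
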